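/- Exact computation of E[log V]: with V = Σ_{σ∈S} P0(σ)·exp(σ̄·√(λ/n)·Σ_{i=1}^n b_i·Z′_i + λQ·X′·σ̄ − (λQ/2)·σ̄²), one has E[log V] = ε·E_{P0}[X²]·(λ/2)·E[Q] + (1−ε)·E[log Σ_{σ∈S} P0(σ)·exp(σ·√(λ/n)·Σ_{i=1}^n b_i·Z′_i + λQ·σ·X′ − (λσ²/2)·Q)]. -/

import Mathlib

open MeasureTheory ProbabilityTheory Filter Finset Real

noncomputable section

/-- The standard Gaussian measure on `ℝ`. -/
def stdGauss : Measure ℝ := gaussianReal 0 1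

/-- The Bernoulli(ε) measure on `Bool`. -/
def bern (ε : ℝ) : Measure Bool :=
  ENNReal.ofReal ε • Measure.dirac true + ENNReal.ofReal (1 - ε) • Measure.dirac false

instance (ε : ℝ) : IsFiniteMeasure (bern ε) := by
  constructor
  rw [bern, Measure.add_apply, Measure.smul_apply, Measure.smul_apply, smul_eq_mul,
    smul_eq_mul, measure_univ, measure_univ, mul_one, mul_one]
  exact ENNReal.add_lt_top.2 ⟨ENNReal.ofReal_lt_top, ENNReal.ofReal_lt_top⟩

/-- The set of pairs `(i, j)` with `i < j`. -/
def pairs (n : ℕ) : Finset (Fin n × Fin n) :=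
  Finset.univ.filter fun p => p.1 < p.2

/-- The ambient sample space of the cavity computation:
`(X, Z, L, Z″, Z̃)` where `X : Fin (n+1) → ℝ` is the signal, `Z` the Gaussian noise,
`L` the Bernoulli revelation variables, and `Z″, Z̃` the auxiliary Gaussians used in `y`. -/
abbrev CavΩ (n : ℕ) :=
  (Fin (n + 1) → ℝ) × ((Fin (n + 1) × Fin (n + 1)) → ℝ) × (Fin (n + 1) → Bool) ×
    (Fin (n + 1) → ℝ) × ((Fin (n + 1) × Fin (n + 1)) → ℝ)

/-- The law of `(X, Z, L, Z″, Z̃)`: all coordinates independent, `X_i` i.i.d. `P0`,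
`Z, Z″, Z̃` i.i.d. standard Gaussian, `L_i` i.i.d. Bernoulli(ε). -/
def cavMeas (P0 : Measure ℝ) [IsProbabilityMeasure P0] (n : ℕ) (ε : ℝ) :
    Measure (CavΩ n) :=
  (Measure.pi fun _ : Fin (n + 1) => P0).prod
    ((Measure.pi fun _ : Fin (n + 1) × Fin (n + 1) => stdGauss).prod
      ((Measure.pi fun _ : Fin (n + 1) => bern ε).prod
        ((Measure.pi fun _ : Fin (n + 1) => stdGauss).prod
          (Measure.pi fun _ : Fin (n + 1) × Fin (n + 1) => stdGauss))))

/-- `x̄_i = L_i X_i + (1 − L_i) x_i`. -/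
def xbar (n : ℕ) (ω : CavΩ n) (x : Fin n → ℝ) : Fin n → ℝ :=
  fun i => if ω.2.2.1 i.castSucc then ω.1 i.castSucc else x i

/-- `σ̄ = (1 − L_{n+1}) σ + L_{n+1} X′`. -/
def sigbar (n : ℕ) (ω : CavΩ n) (σ : ℝ) : ℝ :=
  if ω.2.2.1 (Fin.last n) then ω.1 (Fin.last n) else σ

/-- The cavity Hamiltonian `H′_n(x)`. -/
def Hcav (n : ℕ) (lam : ℝ) (ω : CavΩ n) (x : Fin n → ℝ) : ℝ :=
  ∑ p ∈ pairs n,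
    (Real.sqrt (lam / (n + 1)) * ω.2.1 (p.1.castSucc, p.2.castSucc) * x p.1 * x p.2
      + lam / (n + 1) * ω.1 p.1.castSucc * ω.1 p.2.castSucc * x p.1 * x p.2
      - lam / (2 * (n + 1)) * (x p.1) ^ 2 * (x p.2) ^ 2)

/-- The configurations `x ∈ Sⁿ`. -/
def confs (S : Finset ℝ) (n : ℕ) : Finset (Fin n → ℝ) :=
  Fintype.piFinset fun _ => S

/-- The weight `P0⊗n(x) = Π_i P0({x_i})`. -/
def weight (P0 : Measure ℝ) (n : ℕ) (x : Fin n → ℝ) : ℝ :=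
  ∏ i, (P0 {x i}).toReal

/-- The Gibbs average
`⟨f(x)⟩_{n,ε} = Σ_x P0⊗n(x) f(x̄) exp(H′_n(x̄)) / Σ_x P0⊗n(x) exp(H′_n(x̄))`. -/
def gibbs (P0 : Measure ℝ) (S : Finset ℝ) (n : ℕ) (lam : ℝ) (ω : CavΩ n)
    (f : (Fin n → ℝ) → ℝ) : ℝ :=
  (∑ x ∈ confs S n, weight P0 n x * f (xbar n ω x) * Real.exp (Hcav n lam ω (xbar n ω x)))
    / (∑ x ∈ confs S n, weight P0 n x * Real.exp (Hcav n lam ω (xbar n ω x)))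

/-- The normalized dot product `u · v = (1/n) Σ_i u_i v_i`. -/
def ndot (n : ℕ) (u v : Fin n → ℝ) : ℝ := (1 / n : ℝ) * ∑ i, u i * v i

/-- The cavity field `z(x) = √(λ/n) Σ_i x_i Z′_i + λ (x·X) X′`. -/
def zfield (n : ℕ) (lam : ℝ) (ω : CavΩ n) (x : Fin n → ℝ) : ℝ :=
  Real.sqrt (lam / n) * ∑ i : Fin n, x i * ω.2.1 (i.castSucc, Fin.last n)
    + lam * ndot n x (fun i => ω.1 i.castSucc) * ω.1 (Fin.last n)

/-- The cavity field `s(x) = −(λ/2) (x·x)`. -/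
def sfield (n : ℕ) (lam : ℝ) (x : Fin n → ℝ) : ℝ := -(lam / 2) * ndot n x x

/-- `b_i = ⟨x_i⟩_{n,ε}`. -/
def bcoef (P0 : Measure ℝ) (S : Finset ℝ) (n : ℕ) (lam : ℝ) (ω : CavΩ n)
    (i : Fin n) : ℝ :=
  gibbs P0 S n lam ω (fun x => x i)

/-- `Q = (1/n) Σ_i b_i²`. -/
def Qoverlap (P0 : Measure ℝ) (S : Finset ℝ) (n : ℕ) (lam : ℝ) (ω : CavΩ n) : ℝ :=
  (1 / n : ℝ) * ∑ i : Fin n, (bcoef P0 S n lam ω i) ^ 2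

/-- The cavity field
`y(x) = (√λ/(√2 n)) Σ_i Z″_i x_i² + (√λ/n) Σ_{i<j} x_i x_j Z̃_{ij}
  + (λ/2)((x·X)² − (1/2)(x·x)²)`. -/
def yfield (n : ℕ) (lam : ℝ) (ω : CavΩ n) (x : Fin n → ℝ) : ℝ :=
  Real.sqrt lam / (Real.sqrt 2 * n) * ∑ i : Fin n, ω.2.2.2.1 i.castSucc * (x i) ^ 2
    + Real.sqrt lam / n *
        ∑ p ∈ pairs n, x p.1 * x p.2 * ω.2.2.2.2 (p.1.castSucc, p.2.castSucc)
    + lam / 2 * ((ndot n x (fun i => ω.1 i.castSucc)) ^ 2 - 1 / 2 * (ndot n x x) ^ 2)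

/-- The function `x ↦ Σ_{σ∈S} P0(σ) exp(σ̄ z(x) + σ̄² s(x))`. -/
def fzs (P0 : Measure ℝ) (S : Finset ℝ) (n : ℕ) (lam : ℝ) (ω : CavΩ n)
    (x : Fin n → ℝ) : ℝ :=
  ∑ σ ∈ S, (P0 {σ}).toReal *
    Real.exp (sigbar n ω σ * zfield n lam ω x + (sigbar n ω σ) ^ 2 * sfield n lam x)

/-- `U = ⟨Σ_{σ∈S} P0(σ) exp(σ̄ z(x) + σ̄² s(x))⟩_{n,ε}`. -/
def Ucav (P0 : Measure ℝ) (S : Finset ℝ) (n : ℕ) (lam : ℝ) (ω : CavΩ n) : ℝ :=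
  gibbs P0 S n lam ω (fzs P0 S n lam ω)

/-- `V = Σ_{σ∈S} P0(σ) exp(σ̄ √(λ/n) Σ_i b_i Z′_i + λQ X′ σ̄ − (λQ/2) σ̄²)`. -/
def Vcav (P0 : Measure ℝ) (S : Finset ℝ) (n : ℕ) (lam : ℝ) (ω : CavΩ n) : ℝ :=
  ∑ σ ∈ S, (P0 {σ}).toReal *
    Real.exp (sigbar n ω σ * Real.sqrt (lam / n) *
        (∑ i : Fin n, bcoef P0 S n lam ω i * ω.2.1 (i.castSucc, Fin.last n))
      + lam * Qoverlap P0 S n lam ω * ω.1 (Fin.last n) * sigbar n ω σ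
      - lam * Qoverlap P0 S n lam ω / 2 * (sigbar n ω σ) ^ 2)


instance : IsProbabilityMeasure stdGauss := by
  unfold stdGauss; infer_instance

lemma isProbabilityMeasure_bern {ε : ℝ} (h0 : 0 ≤ ε) (h1 : ε ≤ 1) :
    IsProbabilityMeasure (bern ε) := by
  constructor
  rw [bern, Measure.add_apply, Measure.smul_apply, Measure.smul_apply, smul_eq_mul,
    smul_eq_mul, measure_univ, measure_univ, mul_one, mul_one,
    ← ENNReal.ofReal_add h0 (by linarith)]
  simp

lemma integral_bern {ε : ℝ} (h0 : 0 ≤ ε) (h1 : ε ≤ 1) (f : Bool → ℝ) :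
    ∫ b, f b ∂bern ε = ε * f true + (1 - ε) * f false := by
  rw [bern, integral_add_measure (Integrable.of_finite.smul_measure ENNReal.ofReal_ne_top)
    (Integrable.of_finite.smul_measure ENNReal.ofReal_ne_top), integral_smul_measure,
    integral_smul_measure, integral_dirac, integral_dirac, ENNReal.toReal_ofReal h0,
    ENNReal.toReal_ofReal (by linarith), smul_eq_mul, smul_eq_mul]

/-- Resampling one coordinate of a product of probability measures preserves the product. -/
lemma measurePreserving_update {ι α : Type*} [Fintype ι] [DecidableEq ι] [MeasurableSpace α]
    (ν : Measure α) [IsProbabilityMeasure ν] (i : ι) :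
    MeasurePreserving (fun p : α × (ι → α) => Function.update p.2 i p.1)
      (ν.prod (Measure.pi fun _ => ν)) (Measure.pi fun _ => ν) := by
  have hm : Measurable fun p : α × (ι → α) => Function.update p.2 i p.1 := by
    refine measurable_pi_lambda _ fun j => ?_
    by_cases h : j = i
    · subst h; simpa using measurable_fst
    · simp only [Function.update_of_ne h]; fun_prop
  refine ⟨hm, (Measure.pi_eq fun s hs => ?_).symm⟩
  rw [Measure.map_apply hm (MeasurableSet.univ_pi hs)]
  have : (fun p : α × (ι → α) => Function.update p.2 i p.1) ⁻¹' (Set.univ.pi s)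
      = s i ×ˢ Set.univ.pi (Function.update s i Set.univ) := by
    ext ⟨a, v⟩
    simp only [Set.mem_preimage, Set.mem_univ_pi, Set.mem_prod]
    constructor
    · intro h
      refine ⟨by simpa using h i, fun j => ?_⟩
      by_cases hj : j = i
      · subst hj; simp
      · simpa [Function.update_of_ne hj] using h j
    · rintro ⟨h1, h2⟩ j
      by_cases hj : j = i
      · subst hj; simpa using h1
      · simpa [Function.update_of_ne hj] using h2 j
  rw [this, Measure.prod_prod, Measure.pi_pi, ← Finset.mul_prod_erase _ _ (Finset.mem_univ i),
    ← Finset.mul_prod_erase _ (fun j => ν (s j)) (Finset.mem_univ i)]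
  simp only [Function.update_self, measure_univ, one_mul]
  congr 1
  refine Finset.prod_congr rfl fun j hj => ?_
  rw [Function.update_of_ne (Finset.ne_of_mem_erase hj)]

lemma MeasureTheory.MeasurePreserving.integral_comp_of_measurable {β γ : Type*}
    [MeasurableSpace β] [MeasurableSpace γ] {ν : Measure β} {μ : Measure γ} {Φ : β → γ}
    (h : MeasurePreserving Φ ν μ) {f : γ → ℝ} (hf : Measurable f) :
    ∫ x, f (Φ x) ∂ν = ∫ y, f y ∂μ := by
  rw [← h.map_eq, integral_map h.aemeasurable hf.aestronglyMeasurable]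

lemma MeasureTheory.MeasurePreserving.resample_fst {β γ δ : Type*} [MeasurableSpace β]
    [MeasurableSpace γ] [MeasurableSpace δ] {ν : Measure β} {μ : Measure γ} {ρ : Measure δ}
    [SFinite ν] [SFinite μ] [SFinite ρ] {Φ : β × γ → γ}
    (h : MeasurePreserving Φ (ν.prod μ) μ) :
    MeasurePreserving (fun p : β × γ × δ => (Φ (p.1, p.2.1), p.2.2))
      (ν.prod (μ.prod ρ)) (μ.prod ρ) :=
  (h.prod (MeasurePreserving.id ρ)).comp (measurePreserving_prodAssoc ν μ ρ).symm

lemma MeasureTheory.MeasurePreserving.resample_snd {β γ δ : Type*} [MeasurableSpace β]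
    [MeasurableSpace γ] [MeasurableSpace δ] {ν : Measure β} {μ : Measure γ} {ρ : Measure δ}
    [SFinite ν] [SFinite μ] [SFinite ρ] {Φ : β × γ → γ}
    (h : MeasurePreserving Φ (ν.prod μ) μ) :
    MeasurePreserving (fun p : β × δ × γ => (p.2.1, Φ (p.1, p.2.2)))
      (ν.prod (ρ.prod μ)) (ρ.prod μ) :=
  Measure.measurePreserving_swap.comp <| (h.resample_fst (ρ := ρ)).comp <|
    (MeasurePreserving.id ν).prod Measure.measurePreserving_swap

/-- Replace the cavity signal `X′` by `a`. -/
def setSignal {n : ℕ} (p : ℝ × CavΩ n) : CavΩ n :=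
  (Function.update p.2.1 (Fin.last n) p.1, p.2.2)

/-- Replace the cavity revelation variable `L_{n+1}` by `b`. -/
def setReveal {n : ℕ} (p : Bool × CavΩ n) : CavΩ n :=
  (p.2.1, p.2.2.1, Function.update p.2.2.2.1 (Fin.last n) p.1, p.2.2.2.2)

/-- Flip the sign of the cavity noise `Z′`. -/
def flipNoise {n : ℕ} (ω : CavΩ n) : CavΩ n :=
  (ω.1, fun p => if p.2 = Fin.last n then -ω.2.1 p else ω.2.1 p, ω.2.2)

lemma isProbabilityMeasure_cavMeas (P0 : Measure ℝ) [IsProbabilityMeasure P0] (n : ℕ) {ε : ℝ}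
    (h0 : 0 ≤ ε) (h1 : ε ≤ 1) : IsProbabilityMeasure (cavMeas P0 n ε) := by
  have := isProbabilityMeasure_bern h0 h1
  unfold cavMeas; infer_instance

lemma measurePreserving_setSignal (P0 : Measure ℝ) [IsProbabilityMeasure P0] (n : ℕ) (ε : ℝ) :
    MeasurePreserving setSignal (P0.prod (cavMeas P0 n ε)) (cavMeas P0 n ε) :=
  (measurePreserving_update P0 (Fin.last n)).resample_fst

lemma measurePreserving_setReveal (P0 : Measure ℝ) [IsProbabilityMeasure P0] (n : ℕ) {ε : ℝ}
    (h0 : 0 ≤ ε) (h1 : ε ≤ 1) :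
    MeasurePreserving setReveal ((bern ε).prod (cavMeas P0 n ε)) (cavMeas P0 n ε) := by
  have := isProbabilityMeasure_bern h0 h1
  exact (measurePreserving_update (bern ε) (Fin.last n)).resample_fst.resample_snd.resample_snd

lemma measurePreserving_flipNoise (P0 : Measure ℝ) [IsProbabilityMeasure P0] (n : ℕ) (ε : ℝ) :
    MeasurePreserving flipNoise (cavMeas P0 n ε) (cavMeas P0 n ε) := by
  have hneg : MeasurePreserving (fun x : ℝ => -x) stdGauss stdGauss :=
    ⟨measurable_neg, by simp [stdGauss, gaussianReal_map_neg]⟩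
  have hz : MeasurePreserving
      (fun (z : Fin (n + 1) × Fin (n + 1) → ℝ) (p : Fin (n + 1) × Fin (n + 1)) =>
        if p.2 = Fin.last n then -z p else z p)
      (Measure.pi fun _ => stdGauss) (Measure.pi fun _ => stdGauss) := by
    refine measurePreserving_pi (f := fun (p : Fin (n + 1) × Fin (n + 1)) x =>
        if p.2 = Fin.last n then -x else x)
      (fun _ => stdGauss) (fun _ => stdGauss) fun p => ?_
    by_cases h : p.2 = Fin.last n
    · simpa [h] using hneg
    · simp only [h, if_false]
      exact MeasurePreserving.id stdGauss
  exact (MeasurePreserving.id _).prod (hz.prod (MeasurePreserving.id _))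

section Gibbs

variable {P0 : Measure ℝ} {S : Finset ℝ} {n : ℕ} {lam : ℝ}

/-- `b_i` only depends on the non-cavity variables. -/
lemma bcoef_congr {ω ω' : CavΩ n} (hX : ∀ i : Fin n, ω.1 i.castSucc = ω'.1 i.castSucc)
    (hZ : ∀ i j : Fin n, ω.2.1 (i.castSucc, j.castSucc) = ω'.2.1 (i.castSucc, j.castSucc))
    (hL : ∀ i : Fin n, ω.2.2.1 i.castSucc = ω'.2.2.1 i.castSucc) :
    bcoef P0 S n lam ω = bcoef P0 S n lam ω' := by
  funext i
  simp only [bcoef, gibbs, Hcav, xbar, hX, hZ, hL]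

lemma bcoef_setSignal (a : ℝ) (ω : CavΩ n) :
    bcoef P0 S n lam (setSignal (a, ω)) = bcoef P0 S n lam ω :=
  bcoef_congr (fun i => by simp [setSignal])
    (fun _ _ => rfl) fun _ => rfl

lemma bcoef_setReveal (b : Bool) (ω : CavΩ n) :
    bcoef P0 S n lam (setReveal (b, ω)) = bcoef P0 S n lam ω :=
  bcoef_congr (fun _ => rfl) (fun _ _ => rfl)
    fun i => by simp [setReveal]

lemma bcoef_flipNoise (ω : CavΩ n) :
    bcoef P0 S n lam (flipNoise ω) = bcoef P0 S n lam ω :=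
  bcoef_congr (fun _ => rfl) (fun _ j => by simp [flipNoise]) fun _ => rfl

lemma measurable_xbar (x : Fin n → ℝ) (i : Fin n) :
    Measurable fun ω : CavΩ n => xbar n ω x i := by
  unfold xbar
  refine Measurable.ite ?_ (by fun_prop) measurable_const
  exact (show Measurable fun ω : CavΩ n => ω.2.2.1 i.castSucc by fun_prop)
    (measurableSet_singleton true)

lemma measurable_bcoef (i : Fin n) : Measurable fun ω => bcoef P0 S n lam ω i := by
  have hx := fun x j => measurable_xbar (n := n) x j
  unfold bcoef gibbs Hcav
  fun_prop

lemma measurable_Qoverlap : Measurable fun ω => Qoverlap P0 S n lam ω := by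
  have hb := fun i => measurable_bcoef (P0 := P0) (S := S) (n := n) (lam := lam) i
  unfold Qoverlap
  fun_prop

lemma measurable_Vcav : Measurable fun ω => Vcav P0 S n lam ω := by
  have hb := fun i => measurable_bcoef (P0 := P0) (S := S) (n := n) (lam := lam) i
  have hQ := measurable_Qoverlap (P0 := P0) (S := S) (n := n) (lam := lam)
  have hs : ∀ σ, Measurable fun ω : CavΩ n => sigbar n ω σ := by
    intro σ
    unfold sigbar
    refine Measurable.ite ?_ (by fun_prop) measurable_const
    exact (show Measurable fun ω : CavΩ n => ω.2.2.1 (Fin.last n) by fun_prop)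
      (measurableSet_singleton true)
  unfold Vcav
  fun_prop

lemma abs_bcoef_le {K : ℝ} (hK : 0 ≤ K) (hSK : ∀ x ∈ S, |x| ≤ K) {ω : CavΩ n}
    (hω : ∀ i, |ω.1 i| ≤ K) (i : Fin n) : |bcoef P0 S n lam ω i| ≤ K := by
  have hw : ∀ x, 0 ≤ weight P0 n x := fun x => Finset.prod_nonneg fun _ _ => ENNReal.toReal_nonneg
  have hD : 0 ≤ ∑ x ∈ confs S n, weight P0 n x * Real.exp (Hcav n lam ω (xbar n ω x)) :=
    Finset.sum_nonneg fun x _ => mul_nonneg (hw x) (Real.exp_pos _).le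
  unfold bcoef gibbs
  rw [abs_div, abs_of_nonneg hD]
  refine div_le_of_le_mul₀ hD hK ?_
  rw [Finset.mul_sum]
  refine (Finset.abs_sum_le_sum_abs _ _).trans (Finset.sum_le_sum fun x hx => ?_)
  have hxi : |xbar n ω x i| ≤ K := by
    unfold xbar
    split_ifs
    · exact hω _
    · exact hSK _ (Fintype.mem_piFinset.1 hx i)
  rw [abs_mul, abs_mul, abs_of_nonneg (hw x), Real.abs_exp]
  calc _ = |xbar n ω x i| * (weight P0 n x * Real.exp (Hcav n lam ω (xbar n ω x))) := by ring
    _ ≤ _ := mul_le_mul_of_nonneg_right hxi (mul_nonneg (hw x) (Real.exp_pos _).le)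

lemma Qoverlap_nonneg (ω : CavΩ n) : 0 ≤ Qoverlap P0 S n lam ω := by
  unfold Qoverlap; positivity

lemma Qoverlap_le {K : ℝ} (hK : 0 ≤ K) (hSK : ∀ x ∈ S, |x| ≤ K) {ω : CavΩ n}
    (hω : ∀ i, |ω.1 i| ≤ K) : Qoverlap P0 S n lam ω ≤ K ^ 2 := by
  have h : ∑ i : Fin n, bcoef P0 S n lam ω i ^ 2 ≤ n * K ^ 2 := by
    refine (Finset.sum_le_card_nsmul _ _ (K ^ 2) fun i _ => ?_).trans (by simp)
    exact sq_le_sq' (abs_le.1 (abs_bcoef_le hK hSK hω i)).1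
      (abs_le.1 (abs_bcoef_le hK hSK hω i)).2
  unfold Qoverlap
  rw [one_div_mul_eq_div]
  exact div_le_of_le_mul₀ (by positivity) (by positivity) (by linarith)

end Gibbs

/-- The logarithm of an average of exponentials is bounded by a bound on the exponents. -/
lemma abs_log_sum_mul_exp_le {ι : Type*} {s : Finset ι} {w a : ι → ℝ} {B : ℝ}
    (hw : ∀ i ∈ s, 0 ≤ w i) (hw1 : ∑ i ∈ s, w i = 1) (ha : ∀ i ∈ s, |a i| ≤ B) :
    |Real.log (∑ i ∈ s, w i * Real.exp (a i))| ≤ B := by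
  have hl : Real.exp (-B) ≤ ∑ i ∈ s, w i * Real.exp (a i) := by
    rw [← one_mul (Real.exp (-B)), ← hw1, Finset.sum_mul]
    exact Finset.sum_le_sum fun i hi => mul_le_mul_of_nonneg_left
      (Real.exp_le_exp.2 (abs_le.1 (ha i hi)).1) (hw i hi)
  have hu : ∑ i ∈ s, w i * Real.exp (a i) ≤ Real.exp B := by
    rw [← one_mul (Real.exp B), ← hw1, Finset.sum_mul]
    exact Finset.sum_le_sum fun i hi => mul_le_mul_of_nonneg_left
      (Real.exp_le_exp.2 (abs_le.1 (ha i hi)).2) (hw i hi)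
  have hpos := (Real.exp_pos _).trans_le hl
  exact abs_le.2 ⟨(Real.le_log_iff_exp_le hpos).2 hl, (Real.log_le_iff_le_exp hpos).2 hu⟩

lemma sum_toReal_singleton_eq_one {P0 : Measure ℝ} [IsProbabilityMeasure P0] {S : Finset ℝ}
    (hsupp : P0 ((↑S : Set ℝ)ᶜ) = 0) : ∑ σ ∈ S, (P0 {σ}).toReal = 1 := by
  rw [← ENNReal.toReal_sum fun _ _ => measure_ne_top _ _, sum_measure_singleton,
    (prob_compl_eq_zero_iff S.measurableSet).1 hsupp, ENNReal.toReal_one]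

lemma ae_cavMeas_mem_support {P0 : Measure ℝ} [IsProbabilityMeasure P0] {S : Finset ℝ}
    (hsupp : P0 ((↑S : Set ℝ)ᶜ) = 0) (n : ℕ) (ε : ℝ) :
    ∀ᵐ ω ∂cavMeas P0 n ε, ∀ i, ω.1 i ∈ S := by
  have h : ∀ᵐ v ∂(Measure.pi fun _ : Fin (n + 1) => P0), ∀ i, v i ∈ S := by
    refine ae_all_iff.2 fun i => ?_
    exact (measurePreserving_eval (fun _ : Fin (n + 1) => P0) i).quasiMeasurePreserving.ae
      (p := fun x => x ∈ S) (by rw [ae_iff]; exact hsupp)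
  exact Measure.quasiMeasurePreserving_fst.ae h

lemma integrable_noise (P0 : Measure ℝ) [IsProbabilityMeasure P0] (n : ℕ) {ε : ℝ}
    (h0 : 0 ≤ ε) (h1 : ε ≤ 1) (p : Fin (n + 1) × Fin (n + 1)) :
    Integrable (fun ω : CavΩ n => ω.2.1 p) (cavMeas P0 n ε) := by
  have := isProbabilityMeasure_bern h0 h1
  have hg : Integrable (fun x : ℝ => x) stdGauss := by
    unfold stdGauss; exact IsGaussian.integrable_fun_id
  have hz : Integrable (fun z : Fin (n + 1) × Fin (n + 1) → ℝ => z p)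
      (Measure.pi fun _ => stdGauss) :=
    (measurePreserving_eval (fun _ => stdGauss) p).integrable_comp_of_integrable hg
  exact (hz.comp_fst _).comp_snd _

/-- The cavity Gaussian field `Σ_i b_i Z′_i`. -/
def noiseField (P0 : Measure ℝ) (S : Finset ℝ) (n : ℕ) (lam : ℝ) (ω : CavΩ n) : ℝ :=
  ∑ i : Fin n, bcoef P0 S n lam ω i * ω.2.1 (i.castSucc, Fin.last n)

section Field

variable {P0 : Measure ℝ} {S : Finset ℝ} {n : ℕ} {lam : ℝ}

lemma measurable_noiseField : Measurable fun ω => noiseField P0 S n lam ω := by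
  have hb := fun i => measurable_bcoef (P0 := P0) (S := S) (n := n) (lam := lam) i
  unfold noiseField
  fun_prop

lemma noiseField_flipNoise (ω : CavΩ n) :
    noiseField P0 S n lam (flipNoise ω) = -noiseField P0 S n lam ω := by
  simp only [noiseField, bcoef_flipNoise]
  simp [flipNoise]

lemma Qoverlap_setSignal (a : ℝ) (ω : CavΩ n) :
    Qoverlap P0 S n lam (setSignal (a, ω)) = Qoverlap P0 S n lam ω := by
  simp only [Qoverlap, bcoef_setSignal]

lemma Qoverlap_setReveal (b : Bool) (ω : CavΩ n) :
    Qoverlap P0 S n lam (setReveal (b, ω)) = Qoverlap P0 S n lam ω := by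
  simp only [Qoverlap, bcoef_setReveal]

lemma Vcav_reveal_false (ω : CavΩ n) :
    Vcav P0 S n lam (setReveal (false, ω)) = ∑ σ ∈ S, (P0 {σ}).toReal *
            Real.exp (σ * Real.sqrt (lam / n) *
                (∑ i : Fin n, bcoef P0 S n lam ω i * ω.2.1 (i.castSucc, Fin.last n))
              + lam * Qoverlap P0 S n lam ω * σ * ω.1 (Fin.last n)
              - lam * σ ^ 2 / 2 * Qoverlap P0 S n lam ω) := by
  have hs : ∀ σ, sigbar n (setReveal (false, ω)) σ = σ := fun σ => by
    simp [sigbar, setReveal]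
  simp only [Vcav, hs, bcoef_setReveal, Qoverlap_setReveal]
  refine Finset.sum_congr rfl fun σ _ => ?_
  simp only [setReveal]
  ring_nf

variable [IsProbabilityMeasure P0] {K ε : ℝ}

lemma ae_abs_signal_le (hSK : ∀ x ∈ S, |x| ≤ K) (hsupp : P0 ((↑S : Set ℝ)ᶜ) = 0) :
    ∀ᵐ ω ∂cavMeas P0 n ε, ∀ i, |ω.1 i| ≤ K := by
  filter_upwards [ae_cavMeas_mem_support hsupp n ε] with ω hω i using hSK _ (hω i)

lemma integrable_noiseField (hK : 0 ≤ K) (hSK : ∀ x ∈ S, |x| ≤ K)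
    (hsupp : P0 ((↑S : Set ℝ)ᶜ) = 0) (h0 : 0 ≤ ε) (h1 : ε ≤ 1) :
    Integrable (fun ω => noiseField P0 S n lam ω) (cavMeas P0 n ε) := by
  refine integrable_finsetSum _ fun i _ => ?_
  refine (integrable_noise P0 n h0 h1 _).bdd_mul (c := K)
    (measurable_bcoef i).aestronglyMeasurable ?_
  filter_upwards [ae_abs_signal_le hSK hsupp] with ω hω using abs_bcoef_le hK hSK hω i

lemma integrable_log_Vcav (hK : 0 ≤ K) (hSK : ∀ x ∈ S, |x| ≤ K)
    (hsupp : P0 ((↑S : Set ℝ)ᶜ) = 0) (hlam : 0 ≤ lam) (h0 : 0 ≤ ε) (h1 : ε ≤ 1) :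
    Integrable (fun ω => Real.log (Vcav P0 S n lam ω)) (cavMeas P0 n ε) := by
  have := isProbabilityMeasure_cavMeas P0 n h0 h1
  have hA := (integrable_noiseField (n := n) (lam := lam) hK hSK hsupp h0 h1).abs
  refine ((hA.const_mul (K * Real.sqrt (lam / n))).add
    (integrable_const (lam * K ^ 2 * K * K + lam * K ^ 2 / 2 * K ^ 2))).mono'
    (Real.measurable_log.comp measurable_Vcav).aestronglyMeasurable ?_
  filter_upwards [ae_abs_signal_le hSK hsupp] with ω hω
  rw [Real.norm_eq_abs]
  refine abs_log_sum_mul_exp_le (fun _ _ => ENNReal.toReal_nonneg)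
    (sum_toReal_singleton_eq_one hsupp) fun σ hσ => ?_
  have hs : |sigbar n ω σ| ≤ K := by
    unfold sigbar
    split_ifs
    exacts [hω _, hSK _ hσ]
  have hQ0 := Qoverlap_nonneg (P0 := P0) (S := S) (lam := lam) ω
  have hQ := Qoverlap_le (P0 := P0) (lam := lam) hK hSK hω
  have hX := hω (Fin.last n)
  refine (abs_sub _ _).trans ((add_le_add_left (abs_add_le _ _) _).trans ?_)
  simp only [Pi.add_apply, abs_mul, abs_div, abs_pow, abs_of_nonneg hlam, abs_of_nonneg hQ0,
    abs_of_nonneg (Real.sqrt_nonneg _), Nat.abs_ofNat, add_assoc]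
  refine add_le_add ?_ (add_le_add ?_ ?_)
  · change _ * |noiseField P0 S n lam ω| ≤ _
    gcongr
  · gcongr
  · gcongr

lemma integral_signal_mul_noiseField :
    ∫ ω, ω.1 (Fin.last n) * noiseField P0 S n lam ω ∂cavMeas P0 n ε = 0 := by
  have hm : Measurable fun ω : CavΩ n => ω.1 (Fin.last n) * noiseField P0 S n lam ω :=
    Measurable.mul (by fun_prop) measurable_noiseField
  have h := (measurePreserving_flipNoise P0 n ε).integral_comp_of_measurable hm
  simp only [noiseField_flipNoise, mul_neg, integral_neg] at h
  have h' : ∀ ω : CavΩ n, (flipNoise ω).1 = ω.1 := fun _ => rfl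
  simp only [h'] at h
  linarith

lemma integral_Qoverlap_mul_signal_sq (h0 : 0 ≤ ε) (h1 : ε ≤ 1) :
    ∫ ω, ω.1 (Fin.last n) ^ 2 * Qoverlap P0 S n lam ω ∂cavMeas P0 n ε
      = (∫ x, x ^ 2 ∂P0) * ∫ ω, Qoverlap P0 S n lam ω ∂cavMeas P0 n ε := by
  have := isProbabilityMeasure_cavMeas P0 n h0 h1
  have hm : Measurable fun ω : CavΩ n => ω.1 (Fin.last n) ^ 2 * Qoverlap P0 S n lam ω :=
    Measurable.mul (by fun_prop) measurable_Qoverlap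
  rw [← (measurePreserving_setSignal P0 n ε).integral_comp_of_measurable hm,
    ← integral_prod_mul]
  refine integral_congr_ae (ae_of_all _ fun p => ?_)
  dsimp only
  rw [Qoverlap_setSignal]
  simp [setSignal]

/-- Conditioning on the cavity revelation variable. -/
lemma integral_cavMeas_eq_reveal (h0 : 0 ≤ ε) (h1 : ε ≤ 1) {f : CavΩ n → ℝ}
    (hm : Measurable f) (hf : Integrable f (cavMeas P0 n ε)) :
    ∫ ω, f ω ∂cavMeas P0 n ε
      = ε * ∫ ω, f (setReveal (true, ω)) ∂cavMeas P0 n ε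
        + (1 - ε) * ∫ ω, f (setReveal (false, ω)) ∂cavMeas P0 n ε := by
  have := isProbabilityMeasure_cavMeas P0 n h0 h1
  have hΦ := measurePreserving_setReveal P0 n h0 h1
  rw [← hΦ.integral_comp_of_measurable hm,
    integral_prod (fun p => f (setReveal p)) (hΦ.integrable_comp_of_integrable hf),
    integral_bern h0 h1]

lemma log_Vcav_reveal_true (hsupp : P0 ((↑S : Set ℝ)ᶜ) = 0) (ω : CavΩ n) :
    Real.log (Vcav P0 S n lam (setReveal (true, ω)))
      = Real.sqrt (lam / n) * (ω.1 (Fin.last n) * noiseField P0 S n lam ω)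
        + lam / 2 * (ω.1 (Fin.last n) ^ 2 * Qoverlap P0 S n lam ω) := by
  have hs : ∀ σ, sigbar n (setReveal (true, ω)) σ = ω.1 (Fin.last n) := fun σ => by
    simp [sigbar, setReveal]
  simp only [Vcav, hs, bcoef_setReveal, Qoverlap_setReveal]
  rw [← Finset.sum_mul, sum_toReal_singleton_eq_one hsupp, one_mul, Real.log_exp]
  simp only [noiseField, setReveal]
  ring

end Field

/-- **Exact computation of `E[log V]`**:
`E[log V] = ε E_{P0}[X²] (λ/2) E[Q]
  + (1−ε) E[log Σ_σ P0(σ) exp(σ √(λ/n) Σ_i b_i Z′_i + λQ σ X′ − (λσ²/2) Q)]`. -/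
theorem expected_log_V (P0 : Measure ℝ) [IsProbabilityMeasure P0]
    (S : Finset ℝ) (K : ℝ) (hK : 0 < K) (hSK : ∀ x ∈ S, x ∈ Set.Icc (-K) K)
    (hsupp : P0 ((↑S : Set ℝ)ᶜ) = 0) (lam : ℝ) (hlam : 0 < lam)
    (ε₀ : ℝ) (hε₀ : ε₀ ∈ Set.Ioc (0 : ℝ) 1)
    (n : ℕ) (hn : 1 ≤ n) (ε : ℝ) (hε : ε ∈ Set.Icc (0 : ℝ) ε₀) :
    ∫ ω, Real.log (Vcav P0 S n lam ω) ∂cavMeas P0 n ε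
      = ε * (∫ x, x ^ 2 ∂P0) * (lam / 2) *
          (∫ ω, Qoverlap P0 S n lam ω ∂cavMeas P0 n ε)
        + (1 - ε) * ∫ ω, Real.log (∑ σ ∈ S, (P0 {σ}).toReal *
            Real.exp (σ * Real.sqrt (lam / n) *
                (∑ i : Fin n, bcoef P0 S n lam ω i * ω.2.1 (i.castSucc, Fin.last n))
              + lam * Qoverlap P0 S n lam ω * σ * ω.1 (Fin.last n)
              - lam * σ ^ 2 / 2 * Qoverlap P0 S n lam ω))
          ∂cavMeas P0 n ε := by
  have h0 : 0 ≤ ε := hε.1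
  have h1 : ε ≤ 1 := hε.2.trans hε₀.2
  have hS : ∀ x ∈ S, |x| ≤ K := fun x hx => abs_le.2 (hSK x hx)
  have := isProbabilityMeasure_cavMeas P0 n h0 h1
  have hA : Integrable (fun ω : CavΩ n => ω.1 (Fin.last n) * noiseField P0 S n lam ω)
      (cavMeas P0 n ε) := by
    refine (integrable_noiseField hK.le hS hsupp h0 h1).bdd_mul (c := K)
      (by fun_prop) ?_
    filter_upwards [ae_abs_signal_le hS hsupp] with ω hω using hω _
  have hQ : Integrable (fun ω : CavΩ n => ω.1 (Fin.last n) ^ 2 * Qoverlap P0 S n lam ω)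
      (cavMeas P0 n ε) := by
    refine (integrable_const (K ^ 2 * K ^ 2)).mono'
      (Measurable.mul (by fun_prop) measurable_Qoverlap).aestronglyMeasurable ?_
    filter_upwards [ae_abs_signal_le hS hsupp] with ω hω
    rw [Real.norm_eq_abs, abs_mul, abs_pow, abs_of_nonneg (Qoverlap_nonneg ω)]
    exact mul_le_mul (pow_le_pow_left₀ (abs_nonneg _) (hω _) 2)
      (Qoverlap_le hK.le hS hω) (Qoverlap_nonneg ω) (by positivity)
  rw [integral_cavMeas_eq_reveal (f := fun ω => Real.log (Vcav P0 S n lam ω)) h0 h1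
    (Real.measurable_log.comp measurable_Vcav)
    (integrable_log_Vcav hK.le hS hsupp hlam.le h0 h1)]
  simp only [log_Vcav_reveal_true hsupp, Vcav_reveal_false]
  rw [integral_add (hA.const_mul _) (hQ.const_mul _), integral_const_mul, integral_const_mul,
    integral_signal_mul_noiseField, integral_Qoverlap_mul_signal_sq h0 h1]
  ring

end
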